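/- Assume 0 < β < min(1, 2σ). Then for every 1 ≤ n ≤ N one has Σ_{j=1}^{n} P^{(n)}_{n−j} t_j^{σ−β} ≤ Γ(1−σ) T^{2σ−β}. -/

import Mathlib

/-- The power `x ^ p` with `0 ≤ p ≤ 1` lies below its tangents. -/
theorem mul_rpow_sub_one_mul_le_rpow_sub_rpow {p z h : ℝ} (hp0 : 0 ≤ p) (hp1 : p ≤ 1)
    (hz : 0 < z) (hhz : h ≤ z) : p * z ^ (p - 1) * h ≤ z ^ p - (z - h) ^ p := by
  have hs : -1 ≤ -(h / z) := by
    have : h / z ≤ 1 := (div_le_one hz).2 hhz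
    linarith
  have hB := rpow_one_add_le_one_add_mul_self hs hp0 hp1
  have hpow : (z - h) ^ p = z ^ p * (1 + -(h / z)) ^ p := by
    rw [← Real.mul_rpow hz.le (by linarith)]
    congr 1
    field_simp
    ring
  have hmul := mul_le_mul_of_nonneg_left hB (Real.rpow_nonneg hz.le p)
  have hexp : p * z ^ (p - 1) * h = z ^ p * (p * (h / z)) := by
    rw [Real.rpow_sub_one hz.ne']
    field_simp
  rw [hpow, hexp]
  linarith

/-- A discrete convolution kernel `P` built recursively from `a` is complementary to `a`. -/
theorem sum_complementary_kernel_mul_eq_one {a P : ℕ → ℕ → ℝ} {n : ℕ}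
    (ha0 : ∀ k, 1 ≤ k → k ≤ n → a k 0 ≠ 0)
    (hP0 : P n 0 = 1 / a n 0)
    (hPrec : ∀ k, 1 ≤ k → k < n → P n (n - k) = (1 / a k 0) *
      ∑ j ∈ Finset.Icc (k + 1) n, (a j (j - k - 1) - a j (j - k)) * P n (n - j))
    {k : ℕ} (hk : 1 ≤ k) (hkn : k ≤ n) :
    ∑ j ∈ Finset.Icc k n, P n (n - j) * a j (j - k) = 1 := by
  induction hkn using Nat.decreasingInduction with
  | self => simp [hP0, ha0 n hk le_rfl]
  | of_succ k hkn ih =>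
    have hstep : P n (n - k) * a k 0 =
        ∑ j ∈ Finset.Icc (k + 1) n, (a j (j - k - 1) - a j (j - k)) * P n (n - j) := by
      rw [hPrec k hk hkn]
      have := ha0 k hk hkn.le
      field_simp
    rw [← Finset.add_sum_Ioc_eq_sum_Icc hkn.le, Nat.sub_self, hstep,
      ← Finset.Icc_add_one_left_eq_Ioc, ← Finset.sum_add_distrib, ← ih (by omega)]
    refine Finset.sum_congr rfl fun j _ => ?_
    rw [Nat.sub_sub]
    ring

/-- A complementary kernel of a nonnegative kernel decreasing in its second index is
nonnegative. -/
theorem complementary_kernel_nonneg {a P : ℕ → ℕ → ℝ} {n : ℕ}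
    (ha0 : ∀ k, 1 ≤ k → k ≤ n → 0 < a k 0)
    (hanti : ∀ j k, 1 ≤ k → k < j → j ≤ n → a j (j - k) ≤ a j (j - k - 1))
    (hP0 : P n 0 = 1 / a n 0)
    (hPrec : ∀ k, 1 ≤ k → k < n → P n (n - k) = (1 / a k 0) *
      ∑ j ∈ Finset.Icc (k + 1) n, (a j (j - k - 1) - a j (j - k)) * P n (n - j))
    {k : ℕ} (hk : 1 ≤ k) (hkn : k ≤ n) : 0 ≤ P n (n - k) := by
  induction hm : n - k using Nat.strong_induction_on generalizing k with
  | _ m ih =>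
    subst hm
    obtain rfl | hlt := hkn.eq_or_lt
    · rw [Nat.sub_self, hP0]
      exact one_div_nonneg.2 (ha0 k hk le_rfl).le
    · rw [hPrec k hk hlt]
      refine mul_nonneg (one_div_nonneg.2 (ha0 k hk hkn).le) (Finset.sum_nonneg fun j hj => ?_)
      obtain ⟨hkj, hjn⟩ := Finset.mem_Icc.1 hj
      exact mul_nonneg (sub_nonneg.2 (hanti j k hk hkj hjn))
        (ih (n - j) (by omega) (by omega) hjn rfl)


/-- Assume `0 < β < min(1, 2σ)`. Then for every `1 ≤ n ≤ N` one has
`Σ_{j=1}^{n} P^{(n)}_{n−j} t_j^{σ−β} ≤ Γ(1−σ) T^{2σ−β}` on the graded mesh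
`t_n = T (n/N)^γ`. -/
theorem complementary_kernel_power_sum_bound
    (σ β T γ : ℝ) (hσ0 : 0 < σ) (hσ1 : σ < 1)
    (hβ0 : 0 < β) (hβ1 : β < min 1 (2 * σ)) (hT : 0 < T) (hγ : 1 ≤ γ)
    (N : ℕ) (hN : 1 ≤ N)
    (t : ℕ → ℝ) (ht : ∀ n : ℕ, n ≤ N → t n = T * ((n : ℝ) / (N : ℝ)) ^ γ)
    (a : ℕ → ℕ → ℝ)
    (ha : ∀ n k : ℕ, 1 ≤ k → k ≤ n → n ≤ N →
      a n (n - k) =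
        ((t n - t (k - 1)) ^ (1 - σ) / Real.Gamma (2 - σ)
          - (t n - t k) ^ (1 - σ) / Real.Gamma (2 - σ)) / (t k - t (k - 1)))
    (P : ℕ → ℕ → ℝ)
    (hP0 : ∀ n : ℕ, 1 ≤ n → n ≤ N → P n 0 = 1 / a n 0)
    (hPrec : ∀ n k : ℕ, 1 ≤ k → k ≤ n - 1 → n ≤ N →
      P n (n - k) = (1 / a k 0) *
        ∑ j ∈ Finset.Icc (k + 1) n, (a j (j - k - 1) - a j (j - k)) * P n (n - j)) :
    ∀ n : ℕ, 1 ≤ n → n ≤ N →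
      ∑ j ∈ Finset.Icc 1 n, P n (n - j) * (t j) ^ (σ - β) ≤
        Real.Gamma (1 - σ) * T ^ (2 * σ - β) := by
  intro n hn hnN
  have hNpos : (0 : ℝ) < N := by exact_mod_cast hN
  have ht0 : t 0 = 0 := by
    rw [ht 0 (Nat.zero_le N)]
    simp [Real.zero_rpow (by linarith : γ ≠ 0)]
  have htlt : ∀ i j, i < j → j ≤ N → t i < t j := by
    intro i j hij hj
    rw [ht i (by omega), ht j hj]
    have hdiv : (i : ℝ) / N < (j : ℝ) / N := by gcongr
    have := Real.rpow_lt_rpow (by positivity) hdiv (by linarith : 0 < γ)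
    gcongr
  have htle : ∀ i j, i ≤ j → j ≤ N → t i ≤ t j := fun i j hij hj =>
    hij.eq_or_lt.elim (fun h => h ▸ le_rfl) fun h => (htlt i j h hj).le
  have htN : t N = T := by
    rw [ht N le_rfl, div_self hNpos.ne', Real.one_rpow, mul_one]
  have hΓ : 0 < Real.Gamma (1 - σ) := Real.Gamma_pos_of_pos (by linarith)
  have hΓ2 : Real.Gamma (2 - σ) = (1 - σ) * Real.Gamma (1 - σ) := by
    rw [← Real.Gamma_add_one (by linarith : (1 : ℝ) - σ ≠ 0)]
    congr 1
    ring
  have hΓ2pos : 0 < Real.Gamma (2 - σ) := Real.Gamma_pos_of_pos (by linarith)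
  have ha0 : ∀ k, 1 ≤ k → k ≤ n → 0 < a k 0 := by
    intro k hk hkn
    have h := ha k k hk le_rfl (by omega)
    have hτ : 0 < t k - t (k - 1) := sub_pos.2 (htlt _ _ (by omega) (by omega))
    rw [Nat.sub_self, sub_self, Real.zero_rpow (by linarith), zero_div, sub_zero] at h
    rw [h]
    positivity
  have hanti : ∀ j k, 1 ≤ k → k < j → j ≤ n → a j (j - k) ≤ a j (j - k - 1) := by
    intro j k hk hkj hjn
    rw [Nat.sub_sub, ha j k hk hkj.le (by omega), ha j (k + 1) (by omega) hkj (by omega),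
      Nat.add_sub_cancel]
    simp only [← sub_div, div_right_comm _ (Real.Gamma (2 - σ))]
    have h1 := htlt (k - 1) k (by omega) (by omega)
    have h2 := htlt k (k + 1) (by omega) (by omega)
    have h3 := htle (k + 1) j hkj (by omega)
    have hconc := (Real.concaveOn_rpow (by linarith : 0 ≤ 1 - σ) (by linarith)).slope_anti_adjacent
      (x := t j - t (k + 1)) (y := t j - t k) (z := t j - t (k - 1))
      (Set.mem_Ici.2 (by linarith)) (Set.mem_Ici.2 (by linarith)) (by linarith) (by linarith)
    simp only [sub_sub_sub_cancel_left] at hconc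
    gcongr
  have hPrec' : ∀ k, 1 ≤ k → k < n → P n (n - k) = (1 / a k 0) *
      ∑ j ∈ Finset.Icc (k + 1) n, (a j (j - k - 1) - a j (j - k)) * P n (n - j) :=
    fun k hk hkn => hPrec n k hk (by omega) hnN
  have hone := sum_complementary_kernel_mul_eq_one (fun k hk hkn => (ha0 k hk hkn).ne')
    (hP0 n hn hnN) hPrec' le_rfl hn
  have hlow : ∀ j, 1 ≤ j → j ≤ n → t j ^ (-σ) ≤ Real.Gamma (1 - σ) * a j (j - 1) := by
    intro j hj hjn
    have h1 := htlt 0 1 one_pos hN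
    have hj1 := htle 1 j hj (by omega)
    rw [ht0] at h1
    have htan := mul_rpow_sub_one_mul_le_rpow_sub_rpow (by linarith : 0 ≤ 1 - σ) (by linarith)
      (h1.trans_le hj1) hj1
    rw [show 1 - σ - 1 = -σ by ring] at htan
    rw [ha j 1 le_rfl hj (by omega), Nat.sub_self, ht0, sub_zero, sub_zero, hΓ2, ← sub_div,
      div_div, ← mul_div_assoc, le_div_iff₀ (mul_pos (mul_pos (by linarith) hΓ) h1)]
    calc t j ^ (-σ) * ((1 - σ) * Real.Gamma (1 - σ) * t 1)
        = Real.Gamma (1 - σ) * ((1 - σ) * t j ^ (-σ) * t 1) := by ring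
      _ ≤ _ := by gcongr
  have hβσ : β < 2 * σ := hβ1.trans_le (min_le_right _ _)
  calc ∑ j ∈ Finset.Icc 1 n, P n (n - j) * (t j) ^ (σ - β)
      ≤ ∑ j ∈ Finset.Icc 1 n,
          Real.Gamma (1 - σ) * T ^ (2 * σ - β) * (P n (n - j) * a j (j - 1)) := by
        refine Finset.sum_le_sum fun j hj => ?_
        obtain ⟨hj1, hjn⟩ := Finset.mem_Icc.1 hj
        have hPj := complementary_kernel_nonneg ha0 hanti (hP0 n hn hnN) hPrec' hj1 hjn
        have htj : 0 < t j := ht0 ▸ htlt 0 j hj1 (by omega)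
        have htT : t j ≤ T := htN ▸ htle j N (by omega) le_rfl
        have hpow : t j ^ (2 * σ - β) ≤ T ^ (2 * σ - β) :=
          Real.rpow_le_rpow htj.le htT (by linarith)
        calc P n (n - j) * t j ^ (σ - β)
            = P n (n - j) * (t j ^ (-σ) * t j ^ (2 * σ - β)) := by
              rw [← Real.rpow_add htj]
              congr 2
              ring
          _ ≤ P n (n - j) * (Real.Gamma (1 - σ) * a j (j - 1) * T ^ (2 * σ - β)) :=
              mul_le_mul_of_nonneg_left
                (mul_le_mul (hlow j hj1 hjn) hpow (by positivity)
                  ((by positivity : (0 : ℝ) ≤ t j ^ (-σ)).trans (hlow j hj1 hjn))) hPj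
          _ = _ := by ring
    _ = Real.Gamma (1 - σ) * T ^ (2 * σ - β) := by
        rw [← Finset.mul_sum, hone, mul_one]
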